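/- For every n ≥ 1 and all σ ≤ π in OP_n, one has ∑_{ρ: σ ≤ ρ ≤ π} μ̃(σ,ρ) ζ̃(ρ,π) = δ_{σ,π} and ∑_{ρ: σ ≤ ρ ≤ π} ζ̃(σ,ρ) μ̃(ρ,π) = δ_{σ,π}, where δ_{σ,π} = 1 if σ = π and 0 otherwise; that is, the functions μ̃ and ζ̃ are mutually inverse with respect to convolution on the poset of ordered set partitions. -/

import Mathlib

open Finset

namespace OSPpaper

/-- A *block* is a subset of `[n] = Fin n`. -/
abbrev Block (n : ℕ) := Finset (Fin n)

/-- `l` is an ordered set partition of the ground set `E ⊆ [n]`: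
a finite sequence of pairwise disjoint nonempty subsets of `E` whose union is `E`. -/
def IsOSP {n : ℕ} (E : Finset (Fin n)) (l : List (Block n)) : Prop :=
  (∀ P ∈ l, P.Nonempty) ∧ l.Pairwise (fun P Q => Disjoint P Q) ∧
    (∀ P ∈ l, P ⊆ E) ∧ ∀ i ∈ E, ∃ P ∈ l, i ∈ P

/-- Union of a list of blocks. -/
def unionList {n : ℕ} (l : List (Block n)) : Block n := l.foldr (· ∪ ·) ∅

/-- The order on ordered set partitions: `π ≤ σ` iff every block of `σ` is the union
of a contiguous run of blocks of `π` (runs taken in order). -/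
def OSPle {n : ℕ} (π σ : List (Block n)) : Prop :=
  ∃ L : List (List (Block n)), L.flatten = π ∧ σ = L.map unionList

/-- The restriction `σ⌋_P`: intersect every block with `P` and delete the empty intersections. -/
def restrict {n : ℕ} (σ : List (Block n)) (P : Block n) : List (Block n) :=
  (σ.map (fun Q => Q ∩ P)).filter (fun Q => decide (Q ≠ ∅))

/-- The quasi-meet `π ⋏ σ`: the concatenation `σ⌋_{P₁} σ⌋_{P₂} ⋯ σ⌋_{P_p}`. -/
def qmeet {n : ℕ} (π σ : List (Block n)) : List (Block n) :=
  (π.map (fun P => restrict σ P)).flatten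

/-- Refinement: every block of `σ` is contained in some block of `τ`.
(As a relation on the underlying unordered partitions, this is the refinement order;
in particular `refines τ η` says `τ̄ ≤ η̄`.) -/
def refines {n : ℕ} (σ τ : List (Block n)) : Prop := ∀ P ∈ σ, ∃ Q ∈ τ, P ⊆ Q

/-- An interval partition of `[m]`, with its blocks listed in (the unique) increasing order:
an ordered set partition whose consecutive blocks are completely ordered. -/
def IsIP {m : ℕ} (l : List (Finset (Fin m))) : Prop :=
  IsOSP Finset.univ l ∧ l.Chain' (fun P Q => ∀ a ∈ P, ∀ b ∈ Q, a < b)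

/-- The (0-based) index `π(k)` of the block of `π` containing `k`. -/
def blockIdx {n : ℕ} (π : List (Block n)) (k : Fin n) : ℕ :=
  π.findIdx (fun P => decide (k ∈ P))

/-- The ordered kernel `κ(i₁,…,iₙ)` of a tuple: the nonempty level sets of the tuple,
listed in increasing order of the value. -/
def kernel {n : ℕ} (i : Fin n → ℕ) : List (Block n) :=
  ((Finset.image i Finset.univ).sort (· ≤ ·)).map
    (fun v => Finset.univ.filter (fun k => i k = v))

/-- `[σ:π] = ∏_{P ∈ π} #(σ⌋_P)`. -/
def colonNum {n : ℕ} (σ π : List (Block n)) : ℕ :=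
  (π.map (fun P => (restrict σ P).length)).prod

/-- `[σ:π]! = ∏_{P ∈ π} #(σ⌋_P)!`. -/
def colonFac {n : ℕ} (σ π : List (Block n)) : ℕ :=
  (π.map (fun P => Nat.factorial (restrict σ P).length)).prod

/-- For `τ̄ ≤ η̄` the sequence `(m_1,…,m_s)`: `m_i` is the (0-based) index of the block of `η`
containing the `i`-th block of `τ`. -/
def mseq {n : ℕ} (τ η : List (Block n)) : List ℕ :=
  τ.map (fun T => η.findIdx (fun E => decide (T ⊆ E)))

/-- number of ascents of a sequence -/
def ascL (l : List ℕ) : ℕ := ((l.zip l.tail).filter (fun p => decide (p.1 < p.2))).length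
/-- number of descents of a sequence -/
def desL (l : List ℕ) : ℕ := ((l.zip l.tail).filter (fun p => decide (p.2 < p.1))).length
/-- number of plateaux of a sequence -/
def platL (l : List ℕ) : ℕ := ((l.zip l.tail).filter (fun p => decide (p.1 = p.2))).length

/-- `asc_η(τ)` -/
def ascN {n : ℕ} (τ η : List (Block n)) : ℕ := ascL (mseq τ η)
/-- `des_η(τ)` -/
def desN {n : ℕ} (τ η : List (Block n)) : ℕ := desL (mseq τ η)
/-- `plat_η(τ)` -/
def platN {n : ℕ} (τ η : List (Block n)) : ℕ := platL (mseq τ η)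

/-- lengths of the maximal ascending runs of a sequence -/
def ascRunLengths (l : List ℕ) : List ℕ :=
  (l.splitBy (fun a b => decide (a < b))).map List.length
/-- lengths of the maximal level (constant) runs of a sequence -/
def levelRunLengths (l : List ℕ) : List ℕ :=
  (l.splitBy (fun a b => decide (a = b))).map List.length

/-- `μ̃(σ,π) = (−1)^{|σ|−|π|} / [σ:π]` (real-valued). -/
noncomputable def muR {n : ℕ} (σ π : List (Block n)) : ℝ :=
  (-1 : ℝ) ^ (σ.length - π.length) / (colonNum σ π : ℝ)

/-- `ζ̃(σ,π) = 1 / [σ:π]!` (real-valued). -/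
noncomputable def zetaR {n : ℕ} (σ π : List (Block n)) : ℝ :=
  1 / (colonFac σ π : ℝ)

/-- The Weisner coefficient `w(τ,η) = ∑_{σ ⋏ η = τ} μ̃(σ, 1̂ₙ)`. -/
noncomputable def wcoef {n : ℕ} (τ η : List (Block n)) : ℝ :=
  ∑ᶠ σ ∈ {σ : List (Block n) | IsOSP Finset.univ σ ∧ qmeet σ η = τ},
    muR σ [(Finset.univ : Block n)]

/-- The Goldberg coefficient `g(τ,η) = ∑_{σ ≥ τ} ζ̃(τ,σ) w(σ,η)`. -/
noncomputable def gcoef {n : ℕ} (τ η : List (Block n)) : ℝ :=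
  ∑ᶠ σ ∈ {σ : List (Block n) | IsOSP Finset.univ σ ∧ OSPle τ σ}, zetaR τ σ * wcoef σ η


/-- `μ̃(σ,π) = (−1)^{|σ|−|π|} / [σ:π]` (complex-valued). -/
noncomputable def muC {n : ℕ} (σ π : List (Block n)) : ℂ :=
  (-1 : ℂ) ^ (σ.length - π.length) / (colonNum σ π : ℂ)

/-- `ζ̃(σ,π) = 1 / [σ:π]!` (complex-valued). -/
noncomputable def zetaC {n : ℕ} (σ π : List (Block n)) : ℂ :=
  1 / (colonFac σ π : ℂ)

/-! ### Lists of lists -/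

/-- The ways to cut the list `l` into `m` consecutive (possibly empty) pieces. -/
def splitsInto {α : Type*} [DecidableEq α] : ℕ → List α → Finset (List (List α))
  | 0, l => if l = [] then {[]} else ∅
  | m + 1, l => (range (l.length + 1)).biUnion fun i =>
      (splitsInto m (l.drop i)).image (List.cons (l.take i))

theorem mem_splitsInto {α : Type*} [DecidableEq α] (m : ℕ) (l : List α) (B : List (List α)) :
    B ∈ splitsInto m l ↔ B.flatten = l ∧ B.length = m := by
  induction m generalizing l B with
  | zero =>
    rw [splitsInto]
    split_ifs with h
    · subst h
      simp only [mem_singleton, List.length_eq_zero_iff]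
      exact ⟨fun h => by simp [h], fun h => h.2⟩
    · simp only [notMem_empty, List.length_eq_zero_iff, false_iff]
      rintro ⟨h1, rfl⟩
      exact h (by simpa using h1.symm)
  | succ m ih =>
    simp only [splitsInto, mem_biUnion, mem_range, mem_image, ih]
    constructor
    · rintro ⟨i, -, B', ⟨h1, h2⟩, rfl⟩
      simp [h1, h2]
    · rintro ⟨h1, h2⟩
      cases B with
      | nil => simp at h2
      | cons b B' =>
        subst h1
        exact ⟨b.length, by simp, B', by simpa using h2, by simp⟩

/-- Sums of multiplicative weights over cuttings are coefficients of powers of the generating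
series. -/
theorem sum_splitsInto {α R : Type*} [DecidableEq α] [CommSemiring R] (f : ℕ → R) (m : ℕ)
    (l : List α) :
    ∑ B ∈ splitsInto m l, (B.map fun b => f b.length).prod =
      PowerSeries.coeff l.length (PowerSeries.mk f ^ m) := by
  induction m generalizing l with
  | zero =>
    rw [splitsInto]
    split_ifs with h
    · simp [h]
    · simp [PowerSeries.coeff_one, h]
  | succ m ih =>
    rw [splitsInto, sum_biUnion, pow_succ', PowerSeries.coeff_mul,
      Finset.Nat.sum_antidiagonal_eq_sum_range_succ_mk]
    · refine sum_congr rfl fun i hi => ?_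
      rw [sum_image (by simp [Set.InjOn])]
      have hi' : i ≤ l.length := by simpa [Nat.lt_succ_iff] using hi
      simp [← mul_sum, ih, hi']
    · intro i hi j hj hij
      simp only [coe_range, Set.mem_Iio] at hi hj
      rw [Function.onFun, disjoint_left]
      simp only [mem_image, not_exists, not_and]
      rintro _ ⟨B, -, rfl⟩ B' - h
      have := congrArg List.length (List.cons.inj h).1
      simp only [List.length_take] at this
      omega

theorem length_le_length_flatten {α : Type*} (B : List (List α)) (h : [] ∉ B) :
    B.length ≤ B.flatten.length := by
  induction B with
  | nil => simp
  | cons b B ih =>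
    simp only [List.mem_cons, not_or] at h
    have := ih h.2
    have := List.length_pos_iff.2 (Ne.symm h.1)
    simp only [List.length_cons, List.flatten_cons, List.length_append]
    omega

/-- The ways to cut the list `l` into consecutive nonempty pieces. -/
def splits {α : Type*} [DecidableEq α] (l : List α) : Finset (List (List α)) :=
  (range (l.length + 1)).biUnion fun m => (splitsInto m l).filter fun B => [] ∉ B

theorem mem_splits {α : Type*} [DecidableEq α] (l : List α) (B : List (List α)) :
    B ∈ splits l ↔ B.flatten = l ∧ [] ∉ B := by
  simp only [splits, mem_biUnion, mem_range, mem_filter, mem_splitsInto]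
  constructor
  · rintro ⟨m, -, ⟨h1, -⟩, h2⟩
    exact ⟨h1, h2⟩
  · rintro ⟨rfl, h⟩
    exact ⟨B.length, Nat.lt_succ_iff.2 (length_le_length_flatten B h), ⟨rfl, rfl⟩, h⟩

theorem sum_splits {α R : Type*} [DecidableEq α] [CommSemiring R] (f g : ℕ → R) (hf : f 0 = 0)
    (l : List α) :
    ∑ B ∈ splits l, (B.map fun b => f b.length).prod * g B.length =
      ∑ m ∈ range (l.length + 1), PowerSeries.coeff l.length (PowerSeries.mk f ^ m) * g m := by
  rw [splits, sum_biUnion]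
  · refine sum_congr rfl fun m _ => ?_
    rw [← sum_splitsInto, sum_mul, sum_filter_of_ne]
    · refine sum_congr rfl fun B hB => ?_
      rw [((mem_splitsInto _ _ _).1 hB).2]
    · intro B _ h hB
      exact h (by rw [List.prod_eq_zero (List.mem_map.2 ⟨[], hB, by simpa using hf⟩), zero_mul])
  · intro i _ j _ hij
    rw [Function.onFun, disjoint_left]
    intro B hB hB'
    simp only [mem_filter, mem_splitsInto] at hB hB'
    exact hij (hB.1.2.symm.trans hB'.1.2)

/-- The lists obtained by choosing one element from each of a list of finsets. -/
def choices {β : Type*} [DecidableEq β] : List (Finset β) → Finset (List β)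
  | [] => {[]}
  | s :: S => (s ×ˢ choices S).image fun p => p.1 :: p.2

theorem sum_choices {β R : Type*} [DecidableEq β] [CommSemiring R] (w : β → R)
    (S : List (Finset β)) :
    ∑ N ∈ choices S, (N.map w).prod = (S.map fun s => ∑ b ∈ s, w b).prod := by
  induction S with
  | nil => simp [choices]
  | cons s S ih =>
    rw [choices, sum_image (by rintro ⟨a, b⟩ _ ⟨c, d⟩ _ h; simpa using h), sum_product]
    simp [← mul_sum, ← sum_mul, ih]

theorem mem_choices_splits {α : Type*} [DecidableEq α] (L : List (List α))
    (N : List (List (List α))) :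
    N ∈ choices (L.map splits) ↔ N.map List.flatten = L ∧ ∀ B ∈ N, [] ∉ B := by
  induction L generalizing N with
  | nil => simp +contextual [choices]
  | cons l L ih =>
    simp only [List.map_cons, choices, mem_image, mem_product, Prod.exists, ih, mem_splits]
    constructor
    · rintro ⟨B, N, ⟨⟨rfl, h⟩, rfl, h'⟩, rfl⟩
      simpa using ⟨h, h'⟩
    · rintro ⟨h, h'⟩
      cases N with
      | nil => simp at h
      | cons B N =>
        simp only [List.map_cons, List.cons.injEq, List.mem_cons, forall_eq_or_imp] at h h'
        exact ⟨B, N, ⟨⟨h.1, h'.1⟩, h.2, h'.2⟩, rfl⟩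

theorem exists_of_flatten_eq_map {α β : Type*} (f : α → β) (K : List (List β)) (M : List α)
    (h : K.flatten = M.map f) : ∃ N : List (List α), N.flatten = M ∧ N.map (List.map f) = K := by
  induction K generalizing M with
  | nil => exact ⟨[], by simpa [eq_comm] using h⟩
  | cons k K ih =>
    obtain ⟨a, b, rfl, rfl, hb⟩ := List.append_eq_map_iff.1 h
    obtain ⟨N, rfl, rfl⟩ := ih b hb.symm
    exact ⟨a :: N, by simp⟩

/-! ### Coarsenings of ordered set partitions -/

theorem mem_unionList {n : ℕ} (l : List (Block n)) (i : Fin n) :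
    i ∈ unionList l ↔ ∃ Q ∈ l, i ∈ Q := by
  induction l with
  | nil => simp [unionList]
  | cons a l ih =>
    rw [show unionList (a :: l) = a ∪ unionList l from rfl, mem_union, ih]
    simp

theorem unionList_map_unionList {n : ℕ} (B : List (List (Block n))) :
    unionList (B.map unionList) = unionList B.flatten := by
  ext i
  simp only [mem_unionList, List.mem_map, List.mem_flatten]
  constructor
  · rintro ⟨_, ⟨l, hl, rfl⟩, hi⟩
    obtain ⟨Q, hQ, hi⟩ := (mem_unionList _ _).1 hi
    exact ⟨Q, ⟨l, hl, hQ⟩, hi⟩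
  · rintro ⟨Q, ⟨l, hl, hQ⟩, hi⟩
    exact ⟨_, ⟨l, hl, rfl⟩, (mem_unionList _ _).2 ⟨Q, hQ, hi⟩⟩

theorem unionList_singleton {n : ℕ} (P : Block n) : unionList [P] = P := by
  simp [unionList]

theorem restrict_append {n : ℕ} (σ τ : List (Block n)) (P : Block n) :
    restrict (σ ++ τ) P = restrict σ P ++ restrict τ P := by
  simp [restrict]

theorem restrict_of_disjoint {n : ℕ} (σ : List (Block n)) (P : Block n)
    (h : ∀ Q ∈ σ, Disjoint Q P) : restrict σ P = [] := by
  simp only [restrict, List.filter_eq_nil_iff, List.mem_map]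
  rintro _ ⟨Q, hQ, rfl⟩
  simpa [disjoint_iff_inter_eq_empty] using h Q hQ

theorem restrict_unionList_self {n : ℕ} (l : List (Block n)) (h : ∀ Q ∈ l, Q.Nonempty) :
    restrict l (unionList l) = l := by
  have hmap : l.map (fun Q => Q ∩ unionList l) = l := by
    conv_rhs => rw [← List.map_id l]
    refine List.map_congr_left fun Q hQ => ?_
    exact inter_eq_left.2 fun i hi => (mem_unionList _ _).2 ⟨Q, hQ, hi⟩
  rw [restrict, hmap, List.filter_eq_self]
  intro Q hQ
  simpa using (h Q hQ).ne_empty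

/-- A cutting of an ordered set partition is determined by the induced coarsening. -/
theorem map_restrict_flatten {n : ℕ} (L : List (List (Block n)))
    (hne : ∀ P ∈ L.flatten, P.Nonempty)
    (hd : L.flatten.Pairwise fun P Q => Disjoint P Q) :
    (L.map unionList).map (restrict L.flatten) = L := by
  rw [List.map_map]
  conv_rhs => rw [← List.map_id L]
  refine List.map_congr_left fun l hl => ?_
  obtain ⟨s, t, rfl⟩ := List.append_of_mem hl
  simp only [List.flatten_append, List.flatten_cons, List.pairwise_append, List.mem_append]
    at hd hne
  have h1 : restrict s.flatten (unionList l) = [] := restrict_of_disjoint _ _ fun Q hQ => by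
    rw [disjoint_left]
    intro i hi hi'
    obtain ⟨P, hP, hi'⟩ := (mem_unionList _ _).1 hi'
    exact disjoint_left.1 (hd.2.2 Q hQ P (.inl hP)) hi hi'
  have h2 : restrict t.flatten (unionList l) = [] := restrict_of_disjoint _ _ fun Q hQ => by
    rw [disjoint_left]
    intro i hi hi'
    obtain ⟨P, hP, hi'⟩ := (mem_unionList _ _).1 hi'
    exact disjoint_left.1 (hd.2.1.2.2 P hP Q hQ) hi' hi
  simp only [Function.comp, List.flatten_append, List.flatten_cons, restrict_append, h1, h2,
    restrict_unionList_self l fun Q hQ => hne Q (.inr (.inl hQ))]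
  simp

theorem IsOSP.map_restrict {n : ℕ} {E : Finset (Fin n)} {L : List (List (Block n))}
    (h : IsOSP E L.flatten) : (L.map unionList).map (restrict L.flatten) = L :=
  map_restrict_flatten L h.1 h.2.1

theorem IsOSP.eq_of_map_unionList_eq {n : ℕ} {E : Finset (Fin n)} {L L' : List (List (Block n))}
    (h : IsOSP E L.flatten) (hL : L.flatten = L'.flatten)
    (hu : L.map unionList = L'.map unionList) : L = L' := by
  have h' : IsOSP E L'.flatten := hL ▸ h
  rw [← h.map_restrict, hu, hL, h'.map_restrict]

theorem nil_notMem_of_forall_nonempty {n : ℕ} {L : List (List (Block n))}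
    (h : ∀ P ∈ L.map unionList, P.Nonempty) : [] ∉ L := fun hL => by
  simpa [unionList] using h _ (List.mem_map.2 ⟨_, hL, rfl⟩)

theorem IsOSP.map_unionList {n : ℕ} {E : Finset (Fin n)} {L : List (List (Block n))}
    (h : IsOSP E L.flatten) (hL : [] ∉ L) : IsOSP E (L.map unionList) := by
  obtain ⟨h1, h2, h3, h4⟩ := h
  refine ⟨?_, ?_, ?_, ?_⟩
  · simp only [List.mem_map]
    rintro _ ⟨l, hl, rfl⟩
    obtain ⟨Q, hQ⟩ := List.exists_mem_of_ne_nil l fun h => hL (h ▸ hl)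
    obtain ⟨i, hi⟩ := h1 Q (List.mem_flatten.2 ⟨l, hl, hQ⟩)
    exact ⟨i, (mem_unionList _ _).2 ⟨Q, hQ, hi⟩⟩
  · rw [List.pairwise_map]
    refine (List.pairwise_flatten.1 h2).2.imp fun {a b} hab => ?_
    rw [disjoint_left]
    intro i hi hi'
    obtain ⟨P, hP, hi⟩ := (mem_unionList _ _).1 hi
    obtain ⟨Q, hQ, hi'⟩ := (mem_unionList _ _).1 hi'
    exact disjoint_left.1 (hab P hP Q hQ) hi hi'
  · simp only [List.mem_map]
    rintro _ ⟨l, hl, rfl⟩ i hi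
    obtain ⟨P, hP, hi⟩ := (mem_unionList _ _).1 hi
    exact h3 P (List.mem_flatten.2 ⟨l, hl, hP⟩) hi
  · intro i hi
    obtain ⟨P, hP, hiP⟩ := h4 i hi
    obtain ⟨l, hl, hP⟩ := List.mem_flatten.1 hP
    exact ⟨_, List.mem_map.2 ⟨l, hl, rfl⟩, (mem_unionList _ _).2 ⟨P, hP, hiP⟩⟩

/-- The interval `[σ, π]` is parametrized by the cuttings of the runs of `σ` making up the
blocks of `π`. -/
theorem interval_eq_image {n : ℕ} {E : Finset (Fin n)} {L : List (List (Block n))}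
    (h : IsOSP E L.flatten) :
    {ρ : List (Block n) | IsOSP E ρ ∧ OSPle L.flatten ρ ∧ OSPle ρ (L.map unionList)} =
      (fun N : List (List (List (Block n))) => N.flatten.map unionList) ''
        (choices (L.map splits) : Set (List (List (List (Block n))))) := by
  ext ρ
  simp only [Set.mem_ofPred_eq, Set.mem_image, mem_coe, mem_choices_splits]
  constructor
  · rintro ⟨hρ, ⟨M, hM, rfl⟩, ⟨K, hK, hKL⟩⟩
    obtain ⟨N, rfl, rfl⟩ := exists_of_flatten_eq_map _ _ _ hK
    refine ⟨N, ⟨?_, ?_⟩, rfl⟩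
    · refine (h.eq_of_map_unionList_eq ?_ ?_).symm
      · rw [← hM, List.flatten_flatten]
      · rw [hKL, List.map_map, List.map_map]
        exact List.map_congr_left fun B _ => unionList_map_unionList B
    · intro B hB hnil
      exact nil_notMem_of_forall_nonempty hρ.1 (List.mem_flatten.2 ⟨B, hB, hnil⟩)
  · rintro ⟨N, ⟨rfl, hN⟩, rfl⟩
    rw [← List.flatten_flatten] at h ⊢
    refine ⟨h.map_unionList ?_, ⟨_, rfl, rfl⟩, N.map (List.map unionList), ?_, ?_⟩
    · simpa using hN
    · rw [List.map_flatten]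
    · rw [List.map_map, List.map_map]
      exact List.map_congr_left fun B _ => (unionList_map_unionList B).symm

theorem injOn_choices {n : ℕ} {E : Finset (Fin n)} {L : List (List (Block n))}
    (h : IsOSP E L.flatten) :
    Set.InjOn (fun N : List (List (List (Block n))) => N.flatten.map unionList)
      (choices (L.map splits) : Set (List (List (List (Block n))))) := by
  intro N hN N' hN' he
  simp only [mem_coe, mem_choices_splits] at hN hN'
  obtain ⟨hL, hN⟩ := hN
  obtain ⟨hL', -⟩ := hN'
  have hσ : N.flatten.flatten = L.flatten := by rw [← hL, List.flatten_flatten]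
  have hσ' : N'.flatten.flatten = L.flatten := by rw [← hL', List.flatten_flatten]
  have hM : N.flatten = N'.flatten :=
    (hσ ▸ h).eq_of_map_unionList_eq (hσ.trans hσ'.symm) he
  have hρ : IsOSP E (N.map (List.map unionList)).flatten := by
    rw [← List.map_flatten]
    exact IsOSP.map_unionList (hσ ▸ h) (by simpa using hN)
  have hK : N.map (List.map unionList) = N'.map (List.map unionList) := by
    refine hρ.eq_of_map_unionList_eq ?_ ?_
    · simpa only [List.map_flatten] using he
    · have hcomp : ∀ N : List (List (List (Block n))),
          (N.map (List.map unionList)).map unionList = (N.map List.flatten).map unionList := by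
        intro N
        rw [List.map_map, List.map_map]
        exact List.map_congr_left fun B _ => unionList_map_unionList B
      rw [hcomp, hcomp, hL, hL']
  refine List.eq_iff_flatten_eq.2 ⟨hM, ?_⟩
  simpa [Function.comp_def] using congrArg (List.map List.length) hK

/-- Convolution of two multiplicative functions on an interval of ordered set partitions. -/
theorem finsum_interval {n : ℕ} {E : Finset (Fin n)} {L : List (List (Block n))}
    (h : IsOSP E L.flatten) (hL : [] ∉ L) (f g : ℕ → ℂ) (hf : f 0 = 0)
    (F G : List (Block n) → List (Block n) → ℂ)
    (hF : ∀ M : List (List (Block n)), IsOSP E M.flatten → [] ∉ M →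
      F M.flatten (M.map unionList) = (M.map fun l => f l.length).prod)
    (hG : ∀ M : List (List (Block n)), IsOSP E M.flatten → [] ∉ M →
      G M.flatten (M.map unionList) = (M.map fun l => g l.length).prod) :
    (∑ᶠ ρ ∈ {ρ : List (Block n) | IsOSP E ρ ∧ OSPle L.flatten ρ ∧ OSPle ρ (L.map unionList)},
      F L.flatten ρ * G ρ (L.map unionList)) =
    (L.map fun l => ∑ m ∈ range (l.length + 1),
      PowerSeries.coeff l.length (PowerSeries.mk f ^ m) * g m).prod := by
  rw [interval_eq_image h, finsum_mem_image (injOn_choices h), finsum_mem_coe_finset]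
  simp_rw [← sum_splits f g hf]
  have := sum_choices (fun B : List (List (Block n)) =>
    (B.map fun b => f b.length).prod * g B.length) (L.map splits)
  rw [List.map_map] at this
  refine Eq.trans (sum_congr rfl fun N hN => ?_) this
  obtain ⟨rfl, hne⟩ := (mem_choices_splits _ _).1 hN
  rw [← List.flatten_flatten] at h ⊢
  have hnil : [] ∉ N.flatten := by simpa using hne
  have hρ : IsOSP E (N.map (List.map unionList)).flatten := by
    rw [← List.map_flatten]
    exact h.map_unionList hnil
  have hNnil : [] ∉ N.map (List.map unionList) := by
    intro h0
    obtain ⟨B, hB, hB0⟩ := List.mem_map.1 h0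
    rw [List.map_eq_nil_iff] at hB0
    exact hL (List.mem_map.2 ⟨B, hB, by simp [hB0]⟩)
  have e1 : (N.map (List.map unionList)).flatten = N.flatten.map unionList := by
    rw [List.map_flatten]
  have e2 : (N.map (List.map unionList)).map unionList = (N.map List.flatten).map unionList := by
    rw [List.map_map, List.map_map]
    exact List.map_congr_left fun B _ => unionList_map_unionList B
  have hG' := hG _ hρ hNnil
  rw [e1, e2] at hG'
  rw [hF _ h hnil, hG', List.prod_map_mul, List.map_flatten, List.prod_flatten]
  simp [Function.comp_def]

/-! ### The functions `μ̃` and `ζ̃` -/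

/-- The coefficients of `log (1 + X)`. -/
noncomputable def muCoeff (k : ℕ) : ℂ := (-1) ^ (k - 1) / k

/-- The coefficients of `exp X - 1`. -/
noncomputable def zetaCoeff (k : ℕ) : ℂ := if k = 0 then 0 else 1 / (k.factorial : ℂ)

theorem neg_one_pow_length_sub {α : Type*} (M : List (List α)) (h : [] ∉ M) :
    (-1 : ℂ) ^ (M.flatten.length - M.length) = (M.map fun l => (-1 : ℂ) ^ (l.length - 1)).prod := by
  induction M with
  | nil => simp
  | cons l M ih =>
    simp only [List.mem_cons, not_or] at h
    have h1 := length_le_length_flatten M h.2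
    have h2 := List.length_pos_iff.2 (Ne.symm h.1)
    rw [List.map_cons, List.prod_cons, ← ih h.2, ← pow_add]
    congr 1
    simp only [List.length_cons, List.flatten_cons, List.length_append]
    omega

theorem muC_flatten {n : ℕ} {E : Finset (Fin n)} (M : List (List (Block n)))
    (h : IsOSP E M.flatten) (hM : [] ∉ M) :
    muC M.flatten (M.map unionList) = (M.map fun l => muCoeff l.length).prod := by
  have hc : colonNum M.flatten (M.map unionList) = (M.map List.length).prod := by
    have := congrArg (List.map List.length) h.map_restrict
    rw [← this, colonNum, List.map_map (f := restrict M.flatten)]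
    rfl
  rw [muC, hc, List.length_map, neg_one_pow_length_sub M hM]
  clear hc h hM
  induction M with
  | nil => simp
  | cons l M ih =>
    rw [List.map_cons, List.map_cons, List.map_cons, List.prod_cons, List.prod_cons,
      List.prod_cons, ← ih, Nat.cast_mul, muCoeff, div_mul_div_comm]

theorem zetaC_flatten {n : ℕ} {E : Finset (Fin n)} (M : List (List (Block n)))
    (h : IsOSP E M.flatten) (hM : [] ∉ M) :
    zetaC M.flatten (M.map unionList) = (M.map fun l => zetaCoeff l.length).prod := by
  have hc : colonFac M.flatten (M.map unionList) =
      (M.map fun l => l.length.factorial).prod := by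
    have := congrArg (List.map fun l => l.length.factorial) h.map_restrict
    rw [← this, colonFac, List.map_map (f := restrict M.flatten)]
    rfl
  rw [zetaC, hc]
  clear hc h
  induction M with
  | nil => simp
  | cons l M ih =>
    simp only [List.mem_cons, not_or] at hM
    have hl : l ≠ [] := Ne.symm hM.1
    rw [List.map_cons, List.map_cons, List.prod_cons, List.prod_cons, ← ih hM.2, Nat.cast_mul,
      zetaCoeff, if_neg (by simpa using hl), div_mul_div_comm, one_mul]

open PowerSeries in
theorem coeff_pow_eq_zero_of_lt {R : Type*} [CommSemiring R] (φ : PowerSeries R)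
    (h : coeff 0 φ = 0) {k m : ℕ} (hkm : k < m) : coeff k (φ ^ m) = 0 :=
  coeff_of_lt_order _ (lt_of_lt_of_le (by exact_mod_cast hkm)
    (le_order_pow_of_constantCoeff_eq_zero m (by simpa using h)))

theorem sum_range_eq_coeff_subst (f g : ℕ → ℂ) (hf : f 0 = 0) (k : ℕ) :
    ∑ m ∈ range (k + 1), PowerSeries.coeff k (PowerSeries.mk f ^ m) * g m =
      PowerSeries.coeff k ((PowerSeries.mk g).subst (PowerSeries.mk f)) := by
  rw [PowerSeries.coeff_subst' (.of_constantCoeff_zero' (by simpa using hf)),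
    finsum_eq_sum_of_support_subset (s := range (k + 1))]
  · simp [mul_comm]
  · intro m hm
    by_contra hkm
    simp only [coe_range, Set.mem_Iio, not_lt] at hkm
    exact hm (by simp [coeff_pow_eq_zero_of_lt (PowerSeries.mk f) (by simpa using hf) hkm])

open PowerSeries in
theorem derivative_mk_zetaCoeff : d⁄dX ℂ (mk zetaCoeff) = 1 + mk zetaCoeff := by
  ext k
  rw [coeff_derivative, map_add, coeff_mk, coeff_mk, coeff_one]
  rcases k with _ | k
  · simp [zetaCoeff]
  · have : (k.factorial : ℂ) ≠ 0 := by exact_mod_cast k.factorial_ne_zero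
    have : (k : ℂ) + 1 ≠ 0 := by exact_mod_cast k.succ_ne_zero
    have : (k : ℂ) + 1 + 1 ≠ 0 := by exact_mod_cast (k + 1).succ_ne_zero
    simp only [zetaCoeff, Nat.factorial_succ, Nat.add_eq_zero_iff, one_ne_zero, and_false, if_false]
    push_cast
    field_simp
    simp

open PowerSeries in
theorem one_add_X_mul_derivative_mk_muCoeff : (1 + X) * d⁄dX ℂ (mk muCoeff) = 1 := by
  have h : d⁄dX ℂ (mk muCoeff) = mk fun k => (-1) ^ k := by
    ext k
    have : (k : ℂ) + 1 ≠ 0 := by exact_mod_cast k.succ_ne_zero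
    simp only [coeff_derivative, coeff_mk, muCoeff, Nat.add_sub_cancel]
    push_cast
    field_simp
  rw [h, add_mul, one_mul]
  ext k
  rcases k with _ | k
  · simp
  · simp [coeff_succ_X_mul, coeff_one, pow_succ]

theorem muCoeff_zero : muCoeff 0 = 0 := by simp [muCoeff]

theorem zetaCoeff_zero : zetaCoeff 0 = 0 := by simp [zetaCoeff]

open PowerSeries in
theorem constantCoeff_mk_subst_mk (f g : ℕ → ℂ) (hf : f 0 = 0) (hg : g 0 = 0) :
    constantCoeff ((mk g).subst (mk f) : PowerSeries ℂ) = 0 := by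
  rw [← coeff_zero_eq_constantCoeff_apply, ← sum_range_eq_coeff_subst f g hf]
  simp [hg]

open PowerSeries in
/-- `log (1 + (exp X - 1)) = X`. -/
theorem mk_muCoeff_subst_mk_zetaCoeff :
    (mk muCoeff).subst (mk zetaCoeff) = (X : PowerSeries ℂ) := by
  have hs : HasSubst (mk zetaCoeff) := .of_constantCoeff_zero' (by simpa using zetaCoeff_zero)
  have h := congrArg (substAlgHom (R := ℂ) hs) one_add_X_mul_derivative_mk_muCoeff
  rw [map_mul, map_add, map_one, coe_substAlgHom, subst_X hs, ← derivative_mk_zetaCoeff] at h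
  refine derivative.ext ?_ ?_
  · rw [derivative_subst hs, derivative_X, mul_comm, h]
  · rw [constantCoeff_mk_subst_mk _ _ zetaCoeff_zero muCoeff_zero, constantCoeff_X]

open PowerSeries in
/-- `exp (log (1 + X)) - 1 = X`. -/
theorem mk_zetaCoeff_subst_mk_muCoeff :
    (mk zetaCoeff).subst (mk muCoeff) = (X : PowerSeries ℂ) := by
  have hs : HasSubst (mk muCoeff) := .of_constantCoeff_zero' (by simpa using muCoeff_zero)
  have hM := one_add_X_mul_derivative_mk_muCoeff
  have hM' := congrArg (d⁄dX ℂ) hM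
  have h := congrArg (substAlgHom (R := ℂ) hs) derivative_mk_zetaCoeff
  rw [map_add, map_one, coe_substAlgHom] at h
  have hψ := derivative_subst (f := mk zetaCoeff) hs
  rw [h] at hψ
  have hψ0 := constantCoeff_mk_subst_mk _ _ muCoeff_zero zetaCoeff_zero
  have hM0 : constantCoeff (d⁄dX ℂ (mk muCoeff)) = 1 := by simpa using congrArg constantCoeff hM
  set ψ : PowerSeries ℂ := (mk zetaCoeff).subst (mk muCoeff)
  set u := d⁄dX ℂ (mk muCoeff)
  simp only [Derivation.leibniz, map_add, derivative_one, derivative_X, smul_eq_mul] at hM'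
  have hu : (1 + ψ) * u = 1 := by
    refine derivative.ext ?_ (by simp [hψ0, hM0])
    simp only [Derivation.leibniz, map_add, derivative_one, smul_eq_mul, hψ]
    linear_combination (1 + ψ) * u * hM' - (1 + ψ) * d⁄dX ℂ u * hM
  linear_combination (1 + X) * hu - (1 + ψ) * hM

theorem prod_coeff_X_eq_ite {n : ℕ} {E : Finset (Fin n)} {L : List (List (Block n))}
    (h : IsOSP E L.flatten) :
    (L.map fun l => PowerSeries.coeff l.length (PowerSeries.X : PowerSeries ℂ)).prod =
      if L.flatten = L.map unionList then 1 else 0 := by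
  split_ifs with he
  · refine List.prod_eq_one fun x hx => ?_
    obtain ⟨l, hl, rfl⟩ := List.mem_map.1 hx
    have hs : L = L.flatten.map fun P => [P] :=
      h.eq_of_map_unionList_eq (by rw [← List.flatMap_def, List.flatMap_singleton'])
        (by simp [Function.comp_def, unionList_singleton, he])
    rw [hs] at hl
    obtain ⟨P, -, rfl⟩ := List.mem_map.1 hl
    simp
  · by_contra hne
    refine he ?_
    have hlen : ∀ l ∈ L, l.length = 1 := by
      intro l hl
      by_contra h1
      refine hne (List.prod_eq_zero (List.mem_map.2 ⟨l, hl, ?_⟩))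
      rw [PowerSeries.coeff_X, if_neg h1]
    clear h hne he
    induction L with
    | nil => simp
    | cons l L ih =>
      simp only [List.mem_cons, forall_eq_or_imp] at hlen
      obtain ⟨P, rfl⟩ := List.length_eq_one_iff.1 hlen.1
      simp [unionList_singleton, ih hlen.2]

/-- For every `n ≥ 1` and all `σ ≤ π` in `OP_n`,
`∑_{σ ≤ ρ ≤ π} μ̃(σ,ρ) ζ̃(ρ,π) = δ_{σ,π}` and `∑_{σ ≤ ρ ≤ π} ζ̃(σ,ρ) μ̃(ρ,π) = δ_{σ,π}`:
the functions `μ̃` and `ζ̃` are mutually inverse under convolution on the poset of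
ordered set partitions. -/
theorem statement6 {n : ℕ} (hn : 1 ≤ n) (σ π : List (Block n))
    (hσ : IsOSP Finset.univ σ) (hπ : IsOSP Finset.univ π) (h : OSPle σ π) :
    (∑ᶠ ρ ∈ {ρ : List (Block n) | IsOSP Finset.univ ρ ∧ OSPle σ ρ ∧ OSPle ρ π},
        muC σ ρ * zetaC ρ π) = (if σ = π then 1 else 0) ∧
    (∑ᶠ ρ ∈ {ρ : List (Block n) | IsOSP Finset.univ ρ ∧ OSPle σ ρ ∧ OSPle ρ π},
        zetaC σ ρ * muC ρ π) = (if σ = π then 1 else 0) := by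
  obtain ⟨L, rfl, rfl⟩ := h
  have hL := nil_notMem_of_forall_nonempty hπ.1
  constructor
  · rw [finsum_interval hσ hL muCoeff zetaCoeff muCoeff_zero muC zetaC muC_flatten zetaC_flatten]
    simp_rw [sum_range_eq_coeff_subst _ _ muCoeff_zero, mk_zetaCoeff_subst_mk_muCoeff]
    exact prod_coeff_X_eq_ite hσ
  · rw [finsum_interval hσ hL zetaCoeff muCoeff zetaCoeff_zero zetaC muC zetaC_flatten muC_flatten]
    simp_rw [sum_range_eq_coeff_subst _ _ zetaCoeff_zero, mk_muCoeff_subst_mk_zetaCoeff]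
    exact prod_coeff_X_eq_ite hσ

end OSPpaper
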